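/- arXiv:1202.4389 — 3 statements merged into one kernel-verified Lean document; each statement's English description precedes it below -/
import Mathlib

section
/- Let X be a Banach space and E := X × L¹([−1,0];X) with norm ‖(x,f)‖_E = ‖x‖_X + ‖f‖_{L¹}. For each r ∈ ℝ let (V^{(r)}(t))_{t≥0} be a strongly continuous contraction semigroup on X and Φ(r) : L¹([−1,0];X) → X a bounded linear operator with c := sup_{r∈ℝ} ‖Φ(r)‖ < ∞. Define 𝒯^{(r)}(t)(x,f) := (V^{(r)}(t)x, V^{(r)}_t x + S₀(t)f) and 𝒮^{(r)}(t)(x,f) := (x + tΦ(r)f, f). Then for every n ∈ ℕ, every t > 0, and all parameter values r₁,…,r_n ∈ ℝ, ‖ ∏_{p=n}^{1} 𝒯^{(r_p)}(t/n) 𝒮^{(r_p)}(t/n) ‖_{L(E)} ≤ (1 + t/n)^n (1 + c·t/n)^n ≤ e^{(1+c)t}. -/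
open MeasureTheory Set

noncomputable section

/-- Lebesgue measure restricted to the interval `[-1,0]`;
`Lp X 1 μ01` then plays the role of `L¹([-1,0];X)`. -/
def μ01 : Measure ℝ := volume.restrict (Icc (-1 : ℝ) 0)

/-- One splitting step `𝒯^{(r)}(h) 𝒮^{(r)}(h)` on `E = X × L¹([-1,0];X)`:
`𝒮^{(r)}(h)(x,f) = (x + hΦ(r)f, f)` followed by `𝒯^{(r)}(h)(y,g) = (V^{(r)}(h)y, V^{(r)}_h y + S₀(h)g)`. -/
def splitStep {X : Type*} [NormedAddCommGroup X] [NormedSpace ℝ X]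
    (V : ℝ → ℝ → X →L[ℝ] X) (Vt : ℝ → ℝ → X →L[ℝ] Lp X 1 μ01)
    (S₀ : ℝ → Lp X 1 μ01 →L[ℝ] Lp X 1 μ01) (Φ : ℝ → Lp X 1 μ01 →L[ℝ] X)
    (r h : ℝ) (v : X × Lp X 1 μ01) : X × Lp X 1 μ01 :=
  (V r h (v.1 + h • Φ r v.2), Vt r h (v.1 + h • Φ r v.2) + S₀ h v.2)

lemma lintegral_μ01 (F : ℝ → ENNReal) :
    ∫⁻ σ, F σ ∂μ01 = ∫⁻ σ, (Icc (-1 : ℝ) 0).indicator F σ :=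
  (lintegral_indicator measurableSet_Icc F).symm

lemma norm_shift_le {X : Type*} [NormedAddCommGroup X] {t : ℝ} (ht : 0 ≤ t) (f g : Lp X 1 μ01)
    (hf : (f : ℝ → X) =ᵐ[μ01] fun σ => if σ < -t then g (t + σ) else 0) : ‖f‖ ≤ ‖g‖ := by
  refine (enorm_le_iff_norm_le).1 ?_
  rw [Lp.enorm_def, Lp.enorm_def, eLpNorm_congr_ae hf, eLpNorm_one_eq_lintegral_enorm,
    eLpNorm_one_eq_lintegral_enorm, lintegral_μ01, lintegral_μ01,
    ← lintegral_add_left_eq_self ((Icc (-1 : ℝ) 0).indicator fun σ => ‖g σ‖ₑ) t]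
  refine lintegral_mono fun σ => ?_
  by_cases h1 : σ ∈ Icc (-1 : ℝ) 0
  · by_cases h2 : σ < -t
    · have h3 : t + σ ∈ Icc (-1 : ℝ) 0 := ⟨by linarith [h1.1], by linarith⟩
      simp [indicator_of_mem h1, indicator_of_mem h3, h2]
    · simp [indicator_of_mem h1, h2]
  · simp [indicator_of_notMem h1]

lemma norm_history_le {X : Type*} [NormedAddCommGroup X] {t C : ℝ} (ht : 0 ≤ t) (hC : 0 ≤ C)
    (u : ℝ → X) (hu : ∀ s, 0 ≤ s → ‖u s‖ ≤ C) (f : Lp X 1 μ01)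
    (hf : (f : ℝ → X) =ᵐ[μ01] fun σ => if -t ≤ σ then u (t + σ) else 0) : ‖f‖ ≤ t * C := by
  rw [← Real.norm_of_nonneg (mul_nonneg ht hC)]
  refine (enorm_le_iff_norm_le).1 ?_
  rw [Lp.enorm_def, eLpNorm_congr_ae hf, eLpNorm_one_eq_lintegral_enorm, lintegral_μ01]
  calc _ ≤ ∫⁻ σ, (Icc (-t) 0).indicator (fun _ => ENNReal.ofReal C) σ := by
        refine lintegral_mono fun σ => ?_
        by_cases h1 : σ ∈ Icc (-1 : ℝ) 0
        · by_cases h2 : -t ≤ σ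
          · have h3 : σ ∈ Icc (-t) 0 := ⟨h2, h1.2⟩
            simp only [indicator_of_mem h1, indicator_of_mem h3, h2, if_true]
            rw [← ofReal_norm]
            exact ENNReal.ofReal_le_ofReal (hu _ (by linarith))
          · simp [h2]
        · simp [indicator_of_notMem h1]
    _ = _ := by
        rw [lintegral_indicator measurableSet_Icc, setLIntegral_const, Real.volume_Icc,
          ← ENNReal.ofReal_mul hC, Real.enorm_of_nonneg (mul_nonneg ht hC)]
        ring_nf

/-- stability bound. If every `V^{(r)}` is a strongly continuous contraction
semigroup on `X` and `‖Φ(r)‖ ≤ c` for all `r`, then for all `n`, `t > 0`, and parameters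
`r₁,…,r_n`, the product `∏_{p=n}^{1} 𝒯^{(r_p)}(t/n) 𝒮^{(r_p)}(t/n)` has norm (on `E` with the
1-sum norm) at most `(1+t/n)^n (1+c t/n)^n ≤ e^{(1+c)t}`. -/
theorem statement6
    (X : Type*) [NormedAddCommGroup X] [NormedSpace ℝ X] [CompleteSpace X]
    -- each `V^{(r)}` is a strongly continuous contraction semigroup on `X`
    (V : ℝ → ℝ → X →L[ℝ] X)
    (hV0 : ∀ r : ℝ, V r 0 = 1)
    (hVadd : ∀ r t τ : ℝ, 0 ≤ t → 0 ≤ τ → V r (t + τ) = (V r t).comp (V r τ))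
    (hVcontr : ∀ r t : ℝ, 0 ≤ t → ‖V r t‖ ≤ 1)
    (hVcont : ∀ (r : ℝ) (x : X), ContinuousOn (fun t : ℝ => V r t x) (Ici (0 : ℝ)))
    -- the operators `V^{(r)}_t : X → L¹([-1,0];X)`
    (Vt : ℝ → ℝ → X →L[ℝ] Lp X 1 μ01)
    (hVt : ∀ r t : ℝ, 0 ≤ t → ∀ x : X,
      (Vt r t x : ℝ → X) =ᵐ[μ01] fun σ => if -t ≤ σ then V r (t + σ) x else 0)
    -- the nilpotent left shift semigroup `S₀(t)` on `L¹([-1,0];X)`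
    (S₀ : ℝ → Lp X 1 μ01 →L[ℝ] Lp X 1 μ01)
    (hS₀ : ∀ t : ℝ, 0 ≤ t → ∀ g : Lp X 1 μ01,
      (S₀ t g : ℝ → X) =ᵐ[μ01] fun σ => if σ < -t then g (t + σ) else 0)
    -- the delay operators, uniformly bounded by `c`
    (Φ : ℝ → Lp X 1 μ01 →L[ℝ] X) (c : ℝ) (hc : ∀ r : ℝ, ‖Φ r‖ ≤ c)
    (n : ℕ) (hn : 0 < n) (t : ℝ) (ht : 0 < t) (r : ℕ → ℝ) :
    (∀ (x : X) (f : Lp X 1 μ01),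
      ‖((List.range n).foldl (fun v p => splitStep V Vt S₀ Φ (r p) (t / n) v) (x, f)).1‖ +
        ‖((List.range n).foldl (fun v p => splitStep V Vt S₀ Φ (r p) (t / n) v) (x, f)).2‖
        ≤ (1 + t / n) ^ n * (1 + c * (t / n)) ^ n * (‖x‖ + ‖f‖)) ∧
    (1 + t / n) ^ n * (1 + c * (t / n)) ^ n ≤ Real.exp ((1 + c) * t) := by
  have hnR : (0 : ℝ) < n := by exact_mod_cast hn
  have hc0 : 0 ≤ c := (norm_nonneg _).trans (hc 0)
  obtain ⟨h, hh⟩ : ∃ h, h = t / n := ⟨_, rfl⟩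
  have h0 : 0 ≤ h := hh ▸ (div_pos ht hnR).le
  have hnh : n * h = t := by rw [hh]; field_simp
  rw [← hh]
  have hstep : ∀ (q : ℝ) (v : X × Lp X 1 μ01),
      ‖(splitStep V Vt S₀ Φ q h v).1‖ + ‖(splitStep V Vt S₀ Φ q h v).2‖
        ≤ (1 + h) * (1 + c * h) * (‖v.1‖ + ‖v.2‖) := by
    rintro q ⟨x, f⟩
    simp only [splitStep]
    have hV : ∀ s, 0 ≤ s → ∀ y, ‖V q s y‖ ≤ ‖y‖ := fun s hs y => by
      simpa using (V q s).le_of_opNorm_le (hVcontr q s hs) y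
    have hy : ‖x + h • Φ q f‖ ≤ ‖x‖ + h * (c * ‖f‖) := by
      refine (norm_add_le _ _).trans ?_
      rw [norm_smul, Real.norm_of_nonneg h0]
      gcongr
      exact (Φ q).le_of_opNorm_le (hc q) f
    generalize x + h • Φ q f = y at hy ⊢
    have h1 := hV h h0 y
    have h2 := norm_history_le h0 (norm_nonneg y) (fun s => V q s y) (fun s hs => hV s hs y)
      _ (hVt q h h0 y)
    have h3 := norm_shift_le h0 _ _ (hS₀ h h0 f)
    have h4 := norm_add_le (Vt q h y) (S₀ h f)
    have h5 := mul_le_mul_of_nonneg_left hy (by linarith : 0 ≤ 1 + h)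
    have h6 : 0 ≤ (1 + h) * (c * h) * ‖x‖ := by positivity
    have h7 : 0 ≤ h * ‖f‖ := by positivity
    linarith
  constructor
  · intro x f
    rw [← mul_pow]
    clear hnh hh hnR hn
    induction n with
    | zero => simp
    | succ n ih =>
      rw [List.range_succ, List.foldl_append, pow_succ']
      refine (hstep _ _).trans ?_
      rw [mul_assoc _ (_ ^ n)]
      exact mul_le_mul_of_nonneg_left ih (by positivity)
  · have h1 : 1 + h ≤ Real.exp h := by linarith [Real.add_one_le_exp h]
    have h2 : 1 + c * h ≤ Real.exp (c * h) := by linarith [Real.add_one_le_exp (c * h)]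
    calc (1 + h) ^ n * (1 + c * h) ^ n ≤ Real.exp h ^ n * Real.exp (c * h) ^ n := by gcongr
      _ = Real.exp ((1 + c) * t) := by
        rw [← Real.exp_nat_mul, ← Real.exp_nat_mul, ← Real.exp_add, ← hnh]
        ring_nf
end
end

section
/- Let X be a Banach space and (V(t))_{t≥0} a strongly continuous contraction semigroup on X. On E := X × L¹([−1,0];X) define T(t)(x,f) := (V(t)x, V_t x + S₀(t)f). Then (T(t))_{t≥0} is a strongly continuous semigroup on E: T(0) = I, T(t)T(r) = T(t+r) for all t, r ≥ 0, and t ↦ T(t)(x,f) is continuous for every (x,f) ∈ E. In particular, the identity V_{t+r} = V_t ∘ V(r) + S₀(t) ∘ V_r holds in L(X, L¹([−1,0];X)) for all t, r ≥ 0. -/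
open MeasureTheory Set

noncomputable section

lemma ae_shift_of_ae {p : ℝ → Prop} (h : ∀ᵐ s ∂μ01, p s) {t : ℝ} (ht : 0 ≤ t) :
    ∀ᵐ s ∂μ01, s < -t → p (t + s) := by
  rw [μ01, ae_restrict_iff' measurableSet_Icc] at h ⊢
  filter_upwards [(measurePreserving_add_left volume t).quasiMeasurePreserving.ae h]
    with s hs hmem hlt
  exact hs ⟨by linarith [hmem.1], by linarith⟩

lemma ae_mem_Icc : ∀ᵐ s ∂μ01, s ∈ Icc (-1 : ℝ) 0 :=
  ae_restrict_mem measurableSet_Icc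

/-- Translation is continuous from `ℝ` to `L¹([-1,0];X)`. -/
lemma exists_continuous_translate {X : Type*} [NormedAddCommGroup X] [NormedSpace ℝ X]
    {G : ℝ → X} (hG : Integrable G) :
    ∃ F : ℝ → Lp X 1 μ01, Continuous F ∧ ∀ t, F t =ᵐ[μ01] fun s => G (t + s) := by
  have hp : Fact ((1 : ENNReal) ≠ ⊤) := ⟨ENNReal.one_ne_top⟩
  have hL : MemLp G 1 volume := memLp_one_iff_integrable.2 hG
  refine ⟨fun t => LpToLpRestrictCLM ℝ X ℝ volume 1 (Icc (-1) 0)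
    (DomAddAct.mk t +ᵥ hL.toLp G), ?_, fun t => ?_⟩
  · exact (LpToLpRestrictCLM ℝ X ℝ volume 1 (Icc (-1) 0)).continuous.comp
      ((DomAddAct.continuous_mk (M := ℝ)).vadd continuous_const)
  · refine (LpToLpRestrictCLM_coeFn ℝ _ _).trans (ae_restrict_of_ae ?_)
    rw [DomAddAct.mk_vadd_toLp]
    exact MemLp.coeFn_toLp _

/-- For a strongly continuous contraction semigroup `(V(t))_{t≥0}` on `X`,
the family `T(t)(x,f) := (V(t)x, V_t x + S₀(t)f)` on `E = X × L¹([-1,0];X)` is a strongly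
continuous semigroup: `T(0) = I`, `T(t+r) = T(t)T(r)` for `t,r ≥ 0`, and `t ↦ T(t)(x,f)` is
continuous for every `(x,f)`.  In particular `V_{t+r} = V_t ∘ V(r) + S₀(t) ∘ V_r` holds in
`L(X, L¹([-1,0];X))` for all `t,r ≥ 0`. -/
theorem statement14
    (X : Type*) [NormedAddCommGroup X] [NormedSpace ℝ X] [CompleteSpace X]
    -- `V` is a strongly continuous contraction semigroup on `X`
    (V : ℝ → X →L[ℝ] X)
    (hV0 : V 0 = 1)
    (hVadd : ∀ t r : ℝ, 0 ≤ t → 0 ≤ r → V (t + r) = (V t).comp (V r))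
    (hVcontr : ∀ t : ℝ, 0 ≤ t → ‖V t‖ ≤ 1)
    (hVcont : ∀ x : X, ContinuousOn (fun t : ℝ => V t x) (Ici (0 : ℝ)))
    -- the operator `V_t : X → L¹([-1,0];X)`, `(V_t x)(σ) = V(t+σ)x` for `σ ≥ -t`, `0` else
    (Vt : ℝ → X →L[ℝ] Lp X 1 μ01)
    (hVt : ∀ t : ℝ, 0 ≤ t → ∀ x : X,
      (Vt t x : ℝ → X) =ᵐ[μ01] fun σ => if -t ≤ σ then V (t + σ) x else 0)
    -- the nilpotent left shift semigroup `S₀(t)` on `L¹([-1,0];X)`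
    (S₀ : ℝ → Lp X 1 μ01 →L[ℝ] Lp X 1 μ01)
    (hS₀ : ∀ t : ℝ, 0 ≤ t → ∀ g : Lp X 1 μ01,
      (S₀ t g : ℝ → X) =ᵐ[μ01] fun σ => if σ < -t then g (t + σ) else 0) :
    -- `T(0) = I`
    (∀ (x : X) (f : Lp X 1 μ01), (V 0 x, Vt 0 x + S₀ 0 f) = (x, f)) ∧
    -- `T(t+r) = T(t) T(r)` for `t, r ≥ 0`
    (∀ t r : ℝ, 0 ≤ t → 0 ≤ r → ∀ (x : X) (f : Lp X 1 μ01),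
      (V (t + r) x, Vt (t + r) x + S₀ (t + r) f)
        = (V t (V r x), Vt t (V r x) + S₀ t (Vt r x + S₀ r f))) ∧
    -- strong continuity of `t ↦ T(t)(x,f)` (for `t ≥ 0`, where the semigroup is defined)
    (∀ (x : X) (f : Lp X 1 μ01),
      ContinuousOn (fun t : ℝ => (V t x, Vt t x + S₀ t f)) (Ici (0 : ℝ))) ∧
    -- in particular: `V_{t+r} = V_t ∘ V(r) + S₀(t) ∘ V_r` in `L(X, L¹([-1,0];X))`
    (∀ t r : ℝ, 0 ≤ t → 0 ≤ r →
      Vt (t + r) = (Vt t).comp (V r) + (S₀ t).comp (Vt r)) := by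
  have hVcomp (t r : ℝ) (ht : 0 ≤ t) (hr : 0 ≤ r) (x : X) :
      Vt (t + r) x = Vt t (V r x) + S₀ t (Vt r x) := by
    refine Lp.ext ?_
    filter_upwards [hVt (t + r) (add_nonneg ht hr) x, Lp.coeFn_add (Vt t (V r x)) (S₀ t (Vt r x)),
      hVt t ht (V r x), hS₀ t ht (Vt r x), ae_shift_of_ae (hVt r hr x) ht] with s h₁ h₂ h₃ h₄ h₅
    rw [h₁, h₂, Pi.add_apply, h₃, h₄]
    by_cases hs : s < -t
    · rw [if_neg (not_le.2 hs), if_pos hs, h₅ hs, zero_add]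
      have hiff : -(t + r) ≤ s ↔ -r ≤ t + s := by constructor <;> intro <;> linarith
      simp only [hiff, show t + r + s = r + (t + s) by ring]
    · rw [not_lt] at hs
      rw [if_pos hs, if_neg (not_lt.2 hs), if_pos (by linarith), add_zero,
        show t + r + s = t + s + r by ring, hVadd (t + s) r (by linarith) hr,
        ContinuousLinearMap.comp_apply]
  have hScomp (t r : ℝ) (ht : 0 ≤ t) (hr : 0 ≤ r) (f : Lp X 1 μ01) :
      S₀ (t + r) f = S₀ t (S₀ r f) := by
    refine Lp.ext ?_
    filter_upwards [hS₀ (t + r) (add_nonneg ht hr) f, hS₀ t ht (S₀ r f),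
      ae_shift_of_ae (hS₀ r hr f) ht] with s h₁ h₂ h₃
    rw [h₁, h₂]
    by_cases hs : s < -t
    · have hiff : s < -(t + r) ↔ t + s < -r := by constructor <;> intro <;> linarith
      simp only [if_pos hs, h₃ hs, hiff, show t + r + s = r + (t + s) by ring]
    · rw [if_neg hs, if_neg (by linarith)]
  have hcont (x : X) (f : Lp X 1 μ01) :
      ContinuousOn (fun t : ℝ => Vt t x + S₀ t f) (Ici (0 : ℝ)) := by
    intro t₀ _
    have hV : IntegrableOn (fun s => V s x) (Icc 0 (t₀ + 1)) :=
      ((hVcont x).mono Icc_subset_Ici_self).integrableOn_Icc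
    have hf : IntegrableOn f (Ico (-1) 0) :=
      IntegrableOn.mono_set (L1.integrable_coeFn f) Ico_subset_Icc_self
    obtain ⟨F, hFc, hF⟩ := exists_continuous_translate
      ((hV.integrable_indicator measurableSet_Icc).add (hf.integrable_indicator measurableSet_Ico))
    have heq (t : ℝ) (ht : 0 ≤ t) (ht₁ : t ≤ t₀ + 1) : Vt t x + S₀ t f = F t := by
      refine Lp.ext ?_
      filter_upwards [Lp.coeFn_add (Vt t x) (S₀ t f), hVt t ht x, hS₀ t ht f, hF t, ae_mem_Icc]
        with s h₁ h₂ h₃ h₄ hmem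
      rw [h₁, h₄, Pi.add_apply, h₂, h₃, Pi.add_apply]
      by_cases hs : s < -t
      · rw [if_neg (not_le.2 hs), if_pos hs,
          indicator_of_notMem (fun h => by linarith [h.1]),
          indicator_of_mem (show t + s ∈ Ico (-1) 0 from ⟨by linarith [hmem.1], by linarith⟩),
          zero_add]
      · rw [not_lt] at hs
        rw [if_pos hs, if_neg (not_lt.2 hs),
          indicator_of_mem (show t + s ∈ Icc 0 (t₀ + 1) from ⟨by linarith, by linarith [hmem.2]⟩),
          indicator_of_notMem (fun h => by linarith [h.2])]
    refine hFc.continuousWithinAt.congr_of_eventuallyEq_of_mem ?_ ‹_›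
    filter_upwards [self_mem_nhdsWithin,
      mem_nhdsWithin_of_mem_nhds (Iio_mem_nhds (lt_add_one t₀))] with t ht ht₁
    exact heq t ht (le_of_lt ht₁)
  refine ⟨fun x f => ?_, fun t r ht hr x f => ?_, fun x f => (hVcont x).prodMk (hcont x f),
    fun t r ht hr => ContinuousLinearMap.ext fun x => hVcomp t r ht hr x⟩
  · refine Prod.ext (by simp [hV0]) (Lp.ext ?_)
    have hne : ∀ᵐ s ∂μ01, s ≠ 0 := ae_restrict_of_ae (Measure.ae_ne volume 0)
    filter_upwards [Lp.coeFn_add (Vt 0 x) (S₀ 0 f), hVt 0 le_rfl x, hS₀ 0 le_rfl f,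
      ae_mem_Icc, hne] with s h₁ h₂ h₃ hmem hs
    have hlt : s < 0 := lt_of_le_of_ne hmem.2 hs
    rw [h₁, Pi.add_apply, h₂, h₃]
    simp [hlt, not_le.2 hlt]
  · refine Prod.ext ?_ ?_
    · simp [hVadd t r ht hr]
    · simp only [map_add, hVcomp t r ht hr x, hScomp t r ht hr f, add_assoc]
end
end

section
/- Let b ∈ C¹_b(ℝ) (bounded with bounded continuous derivative) and μ ∈ L^∞(ℝ × [−1,0]) be such that t ↦ μ(t,σ) belongs to C¹_b(ℝ) uniformly in σ. Define Φ(t)g := ∫_{−1}^{0} μ(t,σ)g(σ) dσ for g ∈ L¹([−1,0];ℝ). Fix s ∈ ℝ, x ∈ ℝ, f ∈ L¹([−1,0];ℝ) with f(0) = x, and let u : [s,∞) → ℝ be the continuous solution of u(t) = x + ∫_s^t b(r)u(r) dr + ∫_s^t Φ(r)u_r dr with history u_s = f (where u_t(σ) = u(t+σ) if t+σ ≥ s and u_t(σ) = f(t+σ−s) otherwise). Fix t ≥ s and for n ∈ ℕ set h := (t−s)/n. Define the splitting iteration x₀ := x, f₀ := f, and for k = 1,…,n: x_k := e^{h·b(s+(k−1)h)}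 ( x_{k−1} + h·Φ(s+(k−1)h) f_{k−1} ), f_k(σ) := e^{(h+σ)·b(s+(k−1)h)} ( x_{k−1} + h·Φ(s+(k−1)h) f_{k−1} ) for σ ∈ [−h,0] and f_k(σ) := f_{k−1}(h+σ) for σ ∈ [−1,−h). Then x_n → u(t) as n → ∞. -/
open MeasureTheory Set Filter

noncomputable section

/-- The splitting iteration of the introduction: `x₀ := x`, `f₀ := f` and
`x_k := e^{hb(s+(k-1)h)}(x_{k-1} + hΦ(s+(k-1)h)f_{k-1})`,
`f_k(σ) := e^{(h+σ)b(s+(k-1)h)}(x_{k-1} + hΦ(s+(k-1)h)f_{k-1})` for `σ ∈ [-h,0]` and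
`f_k(σ) := f_{k-1}(h+σ)` for `σ ∈ [-1,-h)`, where
`Φ(t)g = ∫_{-1}^0 μ(t,σ)g(σ)dσ`. -/
def splitIter (b : ℝ → ℝ) (μf : ℝ → ℝ → ℝ) (s h x : ℝ) (f : ℝ → ℝ) : ℕ → ℝ × (ℝ → ℝ)
  | 0 => (x, f)
  | k + 1 =>
    let p := splitIter b μf s h x f k
    let c := p.1 + h * ∫ σ in Icc (-1 : ℝ) 0, μf (s + (k : ℝ) * h) σ * p.2 σ
    (Real.exp (h * b (s + (k : ℝ) * h)) * c,
      fun σ => if -h ≤ σ then Real.exp ((h + σ) * b (s + (k : ℝ) * h)) * c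
        else p.2 (h + σ))

theorem abs_setIntegral_mul_le {S : Set ℝ} {m g : ℝ → ℝ} {M : ℝ}
    (hm : ∀ σ, |m σ| ≤ M) (hg : IntegrableOn g S) :
    |∫ σ in S, m σ * g σ| ≤ M * ∫ σ in S, |g σ| := by
  rw [← integral_const_mul, ← Real.norm_eq_abs]
  refine norm_integral_le_of_norm_le (hg.abs.const_mul M) (Eventually.of_forall fun σ => ?_)
  rw [Real.norm_eq_abs, abs_mul]
  exact mul_le_mul_of_nonneg_right (hm σ) (abs_nonneg _)

theorem integrableOn_bdd_mul {S : Set ℝ} {m g : ℝ → ℝ} {M : ℝ} (hmeas : Measurable m)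
    (hm : ∀ σ, |m σ| ≤ M) (hg : IntegrableOn g S) :
    IntegrableOn (fun σ => m σ * g σ) S :=
  Integrable.bdd_mul hg hmeas.aestronglyMeasurable (Eventually.of_forall hm)

theorem setIntegral_abs_comp_add_le {S : Set ℝ} {g : ℝ → ℝ} (hg : Integrable g) (r : ℝ) :
    ∫ σ in S, |g (r + σ)| ≤ ∫ τ, |g τ| := by
  rw [← integral_add_left_eq_self (fun τ => |g τ|) r]
  exact setIntegral_le_integral (hg.abs.comp_add_left r)
    (Eventually.of_forall fun σ => abs_nonneg _)

/-- The delay term `r ↦ ∫_{-1}^0 m(r,σ) V(r+σ) dσ` is continuous for integrable `V`. -/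
theorem continuous_integral_mul_comp_add {m : ℝ → ℝ → ℝ} {M : ℝ}
    (hmeas : Measurable (Function.uncurry m)) (hm : ∀ r σ, |m r σ| ≤ M)
    (hcont : ∀ σ, Continuous fun r => m r σ) {V : ℝ → ℝ} (hV : Integrable V) :
    Continuous fun r => ∫ σ in Icc (-1 : ℝ) 0, m r σ * V (r + σ) := by
  have hM : 0 ≤ M := (abs_nonneg _).trans (hm 0 0)
  have hmr : ∀ r, Measurable (m r) := fun r => hmeas.of_uncurry_left
  refine continuous_of_uniform_approx_of_continuous fun S hS => ?_
  obtain ⟨ε, hε, hεS⟩ := Metric.mem_uniformity_dist.1 hS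
  obtain ⟨g, hgs, hgV, hgc, hgi⟩ :=
    hV.exists_hasCompactSupport_integral_sub_le (ε := ε / (2 * (M + 1))) (by positivity)
  refine ⟨fun r => ∫ σ in Icc (-1 : ℝ) 0, m r σ * g (r + σ), ?_, fun r => hεS ?_⟩
  · obtain ⟨C, hC⟩ := hgs.exists_bound_of_continuous hgc
    refine continuous_of_dominated (bound := fun _ => M * C) (fun r => ?_) (fun r => ?_)
      (integrable_const _) (Eventually.of_forall fun σ => ?_)
    · exact ((hmr r).aestronglyMeasurable).mul
        (hgc.comp (continuous_const.add continuous_id)).aestronglyMeasurable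
    · refine Eventually.of_forall fun σ => ?_
      rw [norm_mul]
      exact mul_le_mul (hm r σ) (hC _) (norm_nonneg _) hM
    · exact (hcont σ).mul (hgc.comp (continuous_id.add continuous_const))
  · have hi : ∀ {w : ℝ → ℝ}, Integrable w → IntegrableOn (fun σ => w (r + σ)) (Icc (-1 : ℝ) 0) :=
      fun hw => (hw.comp_add_left r).integrableOn
    rw [Real.dist_eq, ← integral_sub (integrableOn_bdd_mul (hmr r) (hm r) (hi hV))
      (integrableOn_bdd_mul (hmr r) (hm r) (hi hgi))]
    simp_rw [← mul_sub]
    calc _ ≤ M * ∫ σ in Icc (-1 : ℝ) 0, |V (r + σ) - g (r + σ)| :=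
          abs_setIntegral_mul_le (hm r) (hi (hV.sub hgi))
      _ ≤ M * (ε / (2 * (M + 1))) := by
          gcongr
          exact (setIntegral_abs_comp_add_le (hV.sub hgi) r).trans hgV
      _ < ε := by
          rw [mul_div_assoc', div_lt_iff₀ (by positivity)]
          nlinarith

theorem integrableOn_shift_history {h : ℝ} (h0 : 0 ≤ h) (h1 : h ≤ 1) {g φ : ℝ → ℝ}
    (hg : IntegrableOn g (Icc (-1 : ℝ) 0)) (hφ : IntegrableOn φ (Icc (-h) 0)) :
    IntegrableOn (fun σ => if -h ≤ σ then φ σ else g (h + σ)) (Icc (-1 : ℝ) 0) := by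
  have hg' : IntegrableOn (fun σ => g (h + σ)) (Ico (-1 : ℝ) (-h)) := by
    have := (hg.mono_set (t := Icc (-1 : ℝ) 0) (s := Ico (h - 1) 0) (by
      intro y hy; exact ⟨by linarith [hy.1], hy.2.le⟩))
    rw [← (measurePreserving_add_left volume h).integrableOn_comp_preimage
      (measurableEmbedding_addLeft h)] at this
    refine this.mono_set fun y hy => ?_
    simp only [mem_preimage, mem_Ico] at hy ⊢
    constructor <;> linarith [hy.1, hy.2]
  rw [← Ico_union_Icc_eq_Icc (show (-1 : ℝ) ≤ -h by linarith) (show -h ≤ 0 by linarith)]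
  refine IntegrableOn.union ?_ ?_
  · exact hg'.congr_fun (fun σ hσ => (if_neg (not_le.2 hσ.2)).symm) measurableSet_Ico
  · exact hφ.congr_fun (fun σ hσ => (if_pos hσ.1).symm) measurableSet_Icc

theorem setIntegral_shift_history_le {h : ℝ} (h0 : 0 ≤ h) (h1 : h ≤ 1) {g φ : ℝ → ℝ} {B : ℝ}
    (hg : IntegrableOn g (Icc (-1 : ℝ) 0)) (hg0 : ∀ σ, 0 ≤ g σ)
    (hφ : IntegrableOn φ (Icc (-h) 0)) (hB : ∀ σ ∈ Icc (-h) 0, φ σ ≤ B) :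
    ∫ σ in Icc (-1 : ℝ) 0, (if -h ≤ σ then φ σ else g (h + σ)) ≤
      (∫ σ in Icc (-1 : ℝ) 0, g σ) + h * B := by
  have hi := integrableOn_shift_history h0 h1 hg hφ
  have hun := Ico_union_Icc_eq_Icc (show (-1 : ℝ) ≤ -h by linarith) (show -h ≤ 0 by linarith)
  rw [← hun] at hi
  have hdis : Disjoint (Ico (-1 : ℝ) (-h)) (Icc (-h) 0) :=
    Set.disjoint_left.2 fun y hy hy' => not_le.2 hy.2 hy'.1
  have e₁ : ∫ σ in Ico (-1 : ℝ) (-h), (if -h ≤ σ then φ σ else g (h + σ)) ≤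
      ∫ σ in Icc (-1 : ℝ) 0, g σ := by
    rw [setIntegral_congr_fun (g := fun σ => g (h + σ)) measurableSet_Ico
      fun σ hσ => if_neg (not_le.2 hσ.2)]
    have : Ico (-1 : ℝ) (-h) = (fun y => h + y) ⁻¹' Ico (h - 1) 0 := by
      ext y
      simp only [mem_preimage, mem_Ico]
      constructor <;> intro hy <;> constructor <;> linarith [hy.1, hy.2]
    rw [this, (measurePreserving_add_left volume h).setIntegral_preimage_emb
      (measurableEmbedding_addLeft h)]
    refine setIntegral_mono_set hg (Eventually.of_forall hg0) (LE.le.eventuallyLE ?_)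
    intro y hy
    exact ⟨by linarith [hy.1], hy.2.le⟩
  have e₂ : ∫ σ in Icc (-h) 0, (if -h ≤ σ then φ σ else g (h + σ)) ≤ h * B := by
    rw [setIntegral_congr_fun (g := φ) measurableSet_Icc fun σ hσ => if_pos hσ.1]
    refine (setIntegral_mono_on hφ (integrableOn_const (by simp)) measurableSet_Icc hB).trans ?_
    simp [h0]
  rw [← hun, setIntegral_union hdis measurableSet_Icc hi.left_of_union hi.right_of_union, hun]
  exact add_le_add e₁ e₂

theorem abs_exp_mul_sub_one_le {β M h θ : ℝ} (hβ : |β| ≤ M) (hhM : h * M ≤ 1) (hθ0 : 0 ≤ θ)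
    (hθh : θ ≤ h) : |Real.exp (θ * β) - 1| ≤ 2 * (h * M) := by
  have hθ : |θ * β| ≤ h * M := by
    rw [abs_mul, abs_of_nonneg hθ0]
    exact mul_le_mul hθh hβ (abs_nonneg _) (hθ0.trans hθh)
  exact (Real.abs_exp_sub_one_le (hθ.trans hhM)).trans (by linarith)

/-- Stability of one splitting step, at an intermediate time `θ`. -/
theorem abs_exp_mul_add_sub_le {β X Y u₀ g D M K N h θ : ℝ} (hθ0 : 0 ≤ θ) (hθh : θ ≤ h)
    (hβ : |β| ≤ M) (hhM : h * M ≤ 1) (hK : |u₀| ≤ K) (hY : |Y - g| ≤ M * D) (hg : |g| ≤ M * N) :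
    |Real.exp (θ * β) * (X + h * Y) - u₀| ≤
      |X - u₀| + 2 * (h * M) * (|X - u₀| + K) + 3 * h * (M * D + M * N) := by
  have hE := abs_exp_mul_sub_one_le hβ hhM hθ0 hθh
  set E := Real.exp (θ * β)
  have hE3 : |E| ≤ 3 := by
    have := abs_add_le (E - 1) 1
    simp only [sub_add_cancel, abs_one] at this
    linarith
  have hX : |X| ≤ |X - u₀| + K := by
    have := abs_add_le (X - u₀) u₀
    simp only [sub_add_cancel] at this
    linarith
  have hY' : |Y| ≤ M * D + M * N := by
    have := abs_add_le (Y - g) g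
    simp only [sub_add_cancel] at this
    linarith
  have h0 : 0 ≤ h := hθ0.trans hθh
  have hM : 0 ≤ M := (abs_nonneg _).trans hβ
  calc |E * (X + h * Y) - u₀| = |(X - u₀) + (E - 1) * X + E * (h * Y)| := by ring_nf
    _ ≤ |X - u₀| + |E - 1| * |X| + |E| * (h * |Y|) := by
      refine (abs_add_le _ _).trans (add_le_add ((abs_add_le _ _).trans ?_) ?_)
      · rw [abs_mul]
      · rw [abs_mul, abs_mul, abs_of_nonneg h0]
    _ ≤ |X - u₀| + 2 * (h * M) * (|X - u₀| + K) + 3 * (h * (M * D + M * N)) := by gcongr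
    _ = _ := by ring

/-- One splitting step compared with one explicit Euler step for the exact solution. -/
theorem abs_exp_mul_add_sub_euler_le {β X Y u₀ g D M K N h : ℝ} (h0 : 0 ≤ h)
    (hβ : |β| ≤ M) (hhM : h * M ≤ 1) (hK : |u₀| ≤ K) (hY : |Y - g| ≤ M * D) (hg : |g| ≤ M * N) :
    |Real.exp (h * β) * (X + h * Y) - (u₀ + h * (β * u₀ + g))| ≤
      |X - u₀| + h * (M * |X - u₀|) + h * (M * D) + (h * M) ^ 2 * (|X - u₀| + K) +
        2 * (h * M) * (h * (M * D + M * N)) := by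
  have hE := abs_exp_mul_sub_one_le hβ hhM h0 le_rfl
  have hθ : |h * β| ≤ h * M := by
    rw [abs_mul, abs_of_nonneg h0]
    gcongr
  have hE2 : |Real.exp (h * β) - 1 - h * β| ≤ (h * M) ^ 2 :=
    (Real.abs_exp_sub_one_sub_id_le (hθ.trans hhM)).trans (sq_le_sq.2 (hθ.trans (le_abs_self _)))
  set E := Real.exp (h * β)
  have hX : |X| ≤ |X - u₀| + K := by
    have := abs_add_le (X - u₀) u₀
    simp only [sub_add_cancel] at this
    linarith
  have hY' : |Y| ≤ M * D + M * N := by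
    have := abs_add_le (Y - g) g
    simp only [sub_add_cancel] at this
    linarith
  have hM : 0 ≤ M := (abs_nonneg _).trans hβ
  calc |E * (X + h * Y) - (u₀ + h * (β * u₀ + g))|
      = |(X - u₀) + h * (β * (X - u₀)) + h * (Y - g) + (E - 1 - h * β) * X
          + (E - 1) * (h * Y)| := by ring_nf
    _ ≤ |X - u₀| + h * (|β| * |X - u₀|) + h * |Y - g| + |E - 1 - h * β| * |X|
          + |E - 1| * (h * |Y|) := by
      refine (abs_add_le _ _).trans (add_le_add ((abs_add_le _ _).trans
        (add_le_add ((abs_add_le _ _).trans (add_le_add ((abs_add_le _ _).trans ?_) ?_)) ?_)) ?_)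
      all_goals simp only [abs_mul, abs_of_nonneg h0, le_refl]
    _ ≤ _ := by gcongr

theorem le_mul_exp_of_affine_recursion {A : ℕ → ℝ} {a c : ℝ} {n : ℕ} (ha : 0 ≤ a) (hc : 0 ≤ c)
    (hA0 : A 0 ≤ 0) (hA : ∀ k < n, A (k + 1) ≤ (1 + a) * A k + c) :
    A n ≤ n * c * Real.exp (n * a) := by
  suffices H : ∀ k ≤ n, A k ≤ k * c * Real.exp (k * a) from H n le_rfl
  intro k
  induction k with
  | zero => intro _; simpa using hA0
  | succ k ih =>
    intro hk
    have h1 : 1 + a ≤ Real.exp a := by linarith [Real.add_one_le_exp a]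
    have h2 : (1 : ℝ) ≤ Real.exp ((k + 1 : ℕ) * a) := Real.one_le_exp (by positivity)
    calc A (k + 1) ≤ (1 + a) * A k + c := hA k hk
      _ ≤ (1 + a) * (k * c * Real.exp (k * a)) + c := by
        gcongr
        exact ih (by omega)
      _ ≤ Real.exp a * (k * c * Real.exp (k * a)) + c * Real.exp ((k + 1 : ℕ) * a) := by
        gcongr
        exact le_mul_of_one_le_right hc h2
      _ = _ := by
        have : ((k + 1 : ℕ) : ℝ) * a = a + k * a := by push_cast; ring
        rw [this, Real.exp_add]
        push_cast
        ring

theorem abs_integral_sub_mul_le {F : ℝ → ℝ} {a h ε : ℝ} (h0 : 0 ≤ h)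
    (hF : ContinuousOn F (Icc a (a + h))) (hε : ∀ r ∈ Icc a (a + h), |F r - F a| ≤ ε) :
    |(∫ r in a..a + h, F r) - h * F a| ≤ h * ε := by
  have hle : a ≤ a + h := by linarith
  have : (∫ r in a..a + h, F r) - h * F a = ∫ r in a..a + h, (F r - F a) := by
    rw [intervalIntegral.integral_sub (hF.intervalIntegrable_of_Icc hle)
      intervalIntegrable_const]
    simp
  rw [this, ← Real.norm_eq_abs]
  refine (intervalIntegral.norm_integral_le_of_norm_le_const (C := ε) fun r hr => ?_).trans ?_
  · rw [uIoc_of_le hle] at hr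
    exact hε r ⟨hr.1.le, hr.2⟩
  · rw [add_sub_cancel_left, abs_of_nonneg h0, mul_comm]

/-- Error propagation in one splitting step for the exact solution `u` extended by the initial
history to `V`: the pointwise error plus the `L¹` error of the history segment. -/
theorem splitting_step_error_le {β M K ε h r t X : ℝ} {m g u V : ℝ → ℝ}
    (hβ : |β| ≤ M) (hmeas : Measurable m) (hm : ∀ σ, |m σ| ≤ M)
    (hg : IntegrableOn g (Icc (-1 : ℝ) 0)) (hV : Integrable V)
    (h0 : 0 ≤ h) (h1 : h ≤ 1) (hhM : h * M ≤ 1) (hrt : r + h ≤ t)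
    (hVu : ∀ τ ∈ Icc r t, V τ = u τ) (hK : |u r| ≤ K)
    (hε : ∀ τ ∈ Icc r (r + h), |u r - u τ| ≤ ε)
    (hstep : |u r + h * (β * u r + ∫ σ in Icc (-1 : ℝ) 0, m σ * V (r + σ)) - u (r + h)|
      ≤ h * ε) :
    |Real.exp (h * β) * (X + h * ∫ σ in Icc (-1 : ℝ) 0, m σ * g σ) - u (r + h)| +
      ∫ σ in Icc (-1 : ℝ) 0, |(if -h ≤ σ then
          Real.exp ((h + σ) * β) * (X + h * ∫ σ in Icc (-1 : ℝ) 0, m σ * g σ)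
          else g (h + σ)) - V (r + h + σ)| ≤
      (1 + h * (1 + 4 * M + 2 * M ^ 2)) *
        (|X - u r| + ∫ σ in Icc (-1 : ℝ) 0, |g σ - V (r + σ)|) +
      h * (2 * ε + h * (M ^ 2 * K + 2 * M ^ 2 * (∫ τ, |V τ|) + 2 * M * K
        + 3 * M * ∫ τ, |V τ|)) := by
  have hM : 0 ≤ M := (abs_nonneg _).trans hβ
  have hVr : IntegrableOn (fun σ => V (r + σ)) (Icc (-1 : ℝ) 0) :=
    (hV.comp_add_left r).integrableOn
  have hgV : IntegrableOn (fun σ => g σ - V (r + σ)) (Icc (-1 : ℝ) 0) := hg.sub hVr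
  have hY : |(∫ σ in Icc (-1 : ℝ) 0, m σ * g σ) - ∫ σ in Icc (-1 : ℝ) 0, m σ * V (r + σ)| ≤
      M * ∫ σ in Icc (-1 : ℝ) 0, |g σ - V (r + σ)| := by
    rw [← integral_sub (integrableOn_bdd_mul hmeas hm hg) (integrableOn_bdd_mul hmeas hm hVr)]
    simp_rw [← mul_sub]
    exact abs_setIntegral_mul_le hm hgV
  have hG : |∫ σ in Icc (-1 : ℝ) 0, m σ * V (r + σ)| ≤ M * ∫ τ, |V τ| :=
    (abs_setIntegral_mul_le hm hVr).trans
      (mul_le_mul_of_nonneg_left (setIntegral_abs_comp_add_le hV r) hM)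
  have hD0 : 0 ≤ ∫ σ in Icc (-1 : ℝ) 0, |g σ - V (r + σ)| :=
    integral_nonneg fun σ => abs_nonneg _
  set Y := ∫ σ in Icc (-1 : ℝ) 0, m σ * g σ
  set G := ∫ σ in Icc (-1 : ℝ) 0, m σ * V (r + σ)
  set N := ∫ τ, |V τ|
  have hpoint : |Real.exp (h * β) * (X + h * Y) - u (r + h)| ≤ _ :=
    (abs_sub_le _ (u r + h * (β * u r + G)) _).trans
      (add_le_add (abs_exp_mul_add_sub_euler_le (X := X) h0 hβ hhM hK hY hG) hstep)
  have hφ : IntegrableOn (fun σ => |Real.exp ((h + σ) * β) * (X + h * Y) - V (r + h + σ)|)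
      (Icc (-h) 0) := by
    refine Integrable.abs (Integrable.sub ?_ (hV.comp_add_left (r + h)).integrableOn)
    exact (Continuous.continuousOn (by fun_prop)).integrableOn_Icc
  have hhist := setIntegral_shift_history_le h0 h1 hgV.abs (fun σ => abs_nonneg _) hφ
    (B := |X - u r| + 2 * (h * M) * (|X - u r| + K) +
      3 * h * (M * (∫ σ in Icc (-1 : ℝ) 0, |g σ - V (r + σ)|) + M * N) + ε) (by
      rintro σ ⟨hσ, hσ'⟩
      rw [hVu _ ⟨by linarith, by linarith⟩]
      refine (abs_sub_le _ (u r) _).trans (add_le_add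
        (abs_exp_mul_add_sub_le (by linarith) (by linarith) hβ hhM hK hY hG)
        (hε _ ⟨by linarith, by linarith⟩)))
  have hcongr : (∫ σ in Icc (-1 : ℝ) 0, |(if -h ≤ σ then
        Real.exp ((h + σ) * β) * (X + h * Y) else g (h + σ)) - V (r + h + σ)|) =
      ∫ σ in Icc (-1 : ℝ) 0, (if -h ≤ σ then
        |Real.exp ((h + σ) * β) * (X + h * Y) - V (r + h + σ)|
        else |g (h + σ) - V (r + (h + σ))|) := by
    congr 1
    ext σ
    split_ifs
    · rfl
    · rw [add_assoc]
  rw [hcongr]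
  set D := ∫ σ in Icc (-1 : ℝ) 0, |g σ - V (r + σ)|
  have he0 := abs_nonneg (X - u r)
  set e := |X - u r|
  have hh : h * h ≤ h := mul_le_of_le_one_left h0 h1
  have k1 : h * h * (M ^ 2 * e) ≤ h * (M ^ 2 * e) := by gcongr
  have k2 : h * h * (M ^ 2 * D) ≤ h * (M ^ 2 * D) := by gcongr
  have k3 : h * h * (M * e) ≤ h * (M * e) := by gcongr
  have k4 : h * h * (M * D) ≤ h * (M * D) := by gcongr
  have k5 : 0 ≤ h * (M * e) := by positivity
  have k6 : 0 ≤ h * (M ^ 2 * e) := by positivity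
  have k7 : 0 ≤ h * D := by positivity
  refine (add_le_add hpoint hhist).trans ?_
  linear_combination k1 + 2 * k2 + 2 * k3 + 3 * k4 + k5 + k6 + k7

theorem integrableOn_splitIter_snd (b : ℝ → ℝ) (μf : ℝ → ℝ → ℝ) (s x : ℝ) {h : ℝ} {f : ℝ → ℝ}
    (h0 : 0 ≤ h) (h1 : h ≤ 1) (hf : IntegrableOn f (Icc (-1 : ℝ) 0)) (k : ℕ) :
    IntegrableOn (splitIter b μf s h x f k).2 (Icc (-1 : ℝ) 0) := by
  induction k with
  | zero => exact hf
  | succ k ih =>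
    exact integrableOn_shift_history h0 h1 ih
      (Continuous.continuousOn (by fun_prop)).integrableOn_Icc

/-- Integrability of the initial history on `[s-1,s)` continued by `u` on `[s,t]`. -/
theorem integrable_indicator_history {s t : ℝ} {f u : ℝ → ℝ}
    (hf : IntegrableOn f (Icc (-1 : ℝ) 0)) (hu : ContinuousOn u (Icc s t)) (hst : s ≤ t) :
    Integrable ((Icc (s - 1) t).indicator fun τ => if s ≤ τ then u τ else f (τ - s)) := by
  rw [integrable_indicator_iff measurableSet_Icc,
    ← Ico_union_Icc_eq_Icc (show s - 1 ≤ s by linarith) hst]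
  refine IntegrableOn.union ?_ ?_
  · have hf' : IntegrableOn (fun τ => f (τ - s)) (Ico (s - 1) s) := by
      rw [← (measurePreserving_sub_right volume s).integrableOn_comp_preimage
        (measurableEmbedding_subRight s)] at hf
      refine hf.mono_set fun τ hτ => ?_
      simp only [mem_preimage, mem_Icc]
      constructor <;> linarith [hτ.1, hτ.2]
    exact hf'.congr_fun (fun τ hτ => (if_neg (not_le.2 hτ.2)).symm) measurableSet_Ico
  · exact hu.integrableOn_Icc.congr_fun (fun τ hτ => (if_pos hτ.1).symm) measurableSet_Icc

/-- convergence of the splitting procedure for the scalar nonautonomous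
delay equation `u̇(t) = b(t)u(t) + ∫_{-1}^0 μ(t,σ)u(t+σ)dσ`.  With `b ∈ C¹_b(ℝ)`,
`μ ∈ L^∞(ℝ×[-1,0])` such that `t ↦ μ(t,σ)` is in `C¹_b(ℝ)` uniformly in `σ`, initial data
`x = f(0)`, `f ∈ L¹([-1,0];ℝ)`, and `u` the solution of the delay equation, the iterates
`x_n` of the splitting procedure with step `h = (t-s)/n` converge to `u(t)`. -/
theorem statement15
    (b : ℝ → ℝ)
    -- `b ∈ C¹_b(ℝ)`
    (hb : ContDiff ℝ 1 b)
    (hbbdd : ∃ Mb : ℝ, ∀ r : ℝ, |b r| ≤ Mb)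
    (hb'bdd : ∃ Mb' : ℝ, ∀ r : ℝ, |deriv b r| ≤ Mb')
    (μf : ℝ → ℝ → ℝ)
    -- `μ ∈ L^∞(ℝ × [-1,0])`
    (hμmeas : Measurable (Function.uncurry μf))
    (hμbdd : ∃ Mμ : ℝ, ∀ (r σ : ℝ), |μf r σ| ≤ Mμ)
    -- `t ↦ μ(t,σ)` belongs to `C¹_b(ℝ)`, uniformly in `σ`
    (hμC1 : ∀ σ : ℝ, ContDiff ℝ 1 (fun r : ℝ => μf r σ))
    (hμ'bdd : ∃ Mμ' : ℝ, ∀ (r σ : ℝ), |deriv (fun r : ℝ => μf r σ) r| ≤ Mμ')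
    (s x : ℝ) (f : ℝ → ℝ)
    -- `f ∈ L¹([-1,0];ℝ)` with `f(0) = x`
    (hf : IntegrableOn f (Icc (-1 : ℝ) 0) volume)
    (hfx : f 0 = x)
    -- `u` is the continuous solution of the delay equation with data `(x,f)` at time `s`
    (u : ℝ → ℝ)
    (hu : ContinuousOn u (Ici s))
    (heq : ∀ t : ℝ, s ≤ t →
      u t = x + (∫ r in s..t, b r * u r)
        + ∫ r in s..t, ∫ σ in Icc (-1 : ℝ) 0,
            μf r σ * (if s ≤ r + σ then u (r + σ) else f (r + σ - s)))
    (t : ℝ) (ht : s ≤ t) :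
    Tendsto (fun n : ℕ => (splitIter b μf s ((t - s) / n) x f n).1)
      atTop (nhds (u t)) := by
  obtain ⟨Mb, hMb⟩ := hbbdd
  obtain ⟨Mμ, hMμ⟩ := hμbdd
  set M := max Mb Mμ
  have hbM : ∀ r, |b r| ≤ M := fun r => (hMb r).trans (le_max_left _ _)
  have hμM : ∀ r σ, |μf r σ| ≤ M := fun r σ => (hMμ r σ).trans (le_max_right _ _)
  have hM : 0 ≤ M := (abs_nonneg _).trans (hbM 0)
  have hu' : ContinuousOn u (Icc s t) := hu.mono fun r hr => hr.1
  set V := (Icc (s - 1) t).indicator fun τ => if s ≤ τ then u τ else f (τ - s) with hVdef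
  have hV : Integrable V := integrable_indicator_history hf hu' ht
  have hVeq : ∀ r ∈ Icc s t, ∀ σ ∈ Icc (-1 : ℝ) 0,
      V (r + σ) = if s ≤ r + σ then u (r + σ) else f (r + σ - s) := fun r hr σ hσ =>
    indicator_of_mem (show r + σ ∈ Icc (s - 1) t from
      ⟨by linarith [hr.1, hσ.1], by linarith [hr.2, hσ.2]⟩) _
  have hVu : ∀ r ∈ Icc s t, V r = u r := fun r hr => by
    rw [hVdef, indicator_of_mem (show r ∈ Icc (s - 1) t from ⟨by linarith [hr.1], hr.2⟩),
      if_pos hr.1]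
  set G : ℝ → ℝ := fun r => ∫ σ in Icc (-1 : ℝ) 0, μf r σ * V (r + σ)
  have hG : Continuous G := continuous_integral_mul_comp_add hμmeas hμM
    (fun σ => (hμC1 σ).continuous) hV
  set F : ℝ → ℝ := fun r => b r * u r + G r
  have hbu : ContinuousOn (fun r => b r * u r) (Icc s t) := hb.continuous.continuousOn.mul hu'
  have hF : ContinuousOn F (Icc s t) := hbu.add hG.continuousOn
  have hFi : ∀ {p q}, s ≤ p → p ≤ q → q ≤ t → IntervalIntegrable F volume p q :=
    fun hp hpq hq => (hF.mono (Icc_subset_Icc hp hq)).intervalIntegrable_of_Icc hpq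
  have huF : ∀ r ∈ Icc s t, u r = x + ∫ τ in s..r, F τ := fun r hr => by
    rw [intervalIntegral.integral_add
      ((hbu.mono (Icc_subset_Icc_right hr.2)).intervalIntegrable_of_Icc hr.1)
      (hG.intervalIntegrable _ _), ← add_assoc, heq r hr.1]
    congr 1
    refine intervalIntegral.integral_congr fun τ hτ => ?_
    rw [uIcc_of_le hr.1] at hτ
    refine setIntegral_congr_fun measurableSet_Icc fun σ hσ => ?_
    simp only [hVeq τ ⟨hτ.1, hτ.2.trans hr.2⟩ σ hσ]
  obtain ⟨K, hK⟩ := isCompact_Icc.exists_bound_of_continuousOn hu'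
  set C := 1 + 4 * M + 2 * M ^ 2
  set R := M ^ 2 * K + 2 * M ^ 2 * (∫ τ, |V τ|) + 2 * M * K + 3 * M * ∫ τ, |V τ|
  have hK0 : 0 ≤ K := (norm_nonneg _).trans (hK s ⟨le_rfl, ht⟩)
  have hN0 : 0 ≤ ∫ τ, |V τ| := integral_nonneg fun τ => abs_nonneg _
  have hstep0 : Tendsto (fun n : ℕ => (t - s) / n) atTop (nhds 0) :=
    tendsto_const_div_atTop_nhds_zero_nat _
  have herr : ∀ ε > 0, ∀ᶠ n : ℕ in atTop,
      |(splitIter b μf s ((t - s) / n) x f n).1 - u t| ≤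
        (t - s) * (2 * ε + (t - s) / n * R) * Real.exp ((t - s) * C) := by
    intro ε hε
    obtain ⟨δ₁, hδ₁, H₁⟩ := Metric.uniformContinuousOn_iff.1
      (isCompact_Icc.uniformContinuousOn_of_continuous hu') ε hε
    obtain ⟨δ₂, hδ₂, H₂⟩ := Metric.uniformContinuousOn_iff.1
      (isCompact_Icc.uniformContinuousOn_of_continuous hF) ε hε
    have hMstep : Tendsto (fun n : ℕ => (t - s) / n * M) atTop (nhds 0) := by
      simpa using hstep0.mul_const M
    filter_upwards [hstep0.eventually_lt_const hδ₁, hstep0.eventually_lt_const hδ₂,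
      hstep0.eventually_le_const one_pos, hMstep.eventually_le_const one_pos,
      eventually_gt_atTop 0] with n hn₁ hn₂ h1 hhM hn
    set h := (t - s) / n
    have h0 : 0 ≤ h := div_nonneg (by linarith) (Nat.cast_nonneg n)
    have hnh : n * h = t - s := mul_div_cancel₀ _ (by positivity)
    set P := splitIter b μf s h x f
    have hA := le_mul_exp_of_affine_recursion (n := n) (a := h * C) (c := h * (2 * ε + h * R))
      (A := fun k => |(P k).1 - u (s + k * h)| +
        ∫ σ in Icc (-1 : ℝ) 0, |(P k).2 σ - V (s + k * h + σ)|)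
      (by positivity) (by positivity) ?_ ?_
    · simp only [← mul_assoc, hnh, add_sub_cancel] at hA
      exact (le_add_of_nonneg_right (integral_nonneg fun σ => abs_nonneg _)).trans hA
    · have hus : u s = x := by simpa using huF s ⟨le_rfl, ht⟩
      have hz : ∫ σ in Icc (-1 : ℝ) 0, |f σ - V (s + σ)| = 0 := by
        refine setIntegral_eq_zero_of_forall_eq_zero fun σ hσ => ?_
        rw [hVeq s ⟨le_rfl, ht⟩ σ hσ]
        split_ifs with hs
        · obtain rfl : σ = 0 := le_antisymm hσ.2 (by linarith)
          simp [hfx, hus]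
        · simp
      have hP0 : P 0 = (x, f) := rfl
      simp [hP0, hus, hz]
    · intro k hk
      have hkn : (k : ℝ) + 1 ≤ n := by exact_mod_cast hk
      have hkh : ((k : ℝ) + 1) * h ≤ t - s := hnh ▸ mul_le_mul_of_nonneg_right hkn h0
      have hk0 : 0 ≤ (k : ℝ) * h := by positivity
      have hr : s + k * h ∈ Icc s t := ⟨by linarith, by linarith⟩
      have hsucc : s + ((k + 1 : ℕ) : ℝ) * h = s + k * h + h := by push_cast; ring
      have hmem : ∀ τ ∈ Icc (s + k * h) (s + k * h + h), τ ∈ Icc s t := fun τ hτ =>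
        ⟨hr.1.trans hτ.1, by linarith [hτ.2]⟩
      have hdist : ∀ τ ∈ Icc (s + k * h) (s + k * h + h), dist (s + k * h) τ ≤ h := fun τ hτ => by
        rw [Real.dist_eq, abs_le]
        constructor <;> linarith [hτ.1, hτ.2]
      simp only [hsucc]
      refine splitting_step_error_le (t := t) (hbM _) (hμmeas.of_uncurry_left) (hμM _)
        (integrableOn_splitIter_snd b μf s x h0 h1 hf k) hV h0 h1 hhM (by linarith)
        (fun τ hτ => hVu τ ⟨hr.1.trans hτ.1, hτ.2⟩) (hK _ hr)
        (fun τ hτ => (H₁ _ hr _ (hmem τ hτ) ((hdist τ hτ).trans_lt hn₁)).le) ?_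
      have hr' := hmem (s + k * h + h) ⟨by linarith, le_rfl⟩
      have hint := abs_integral_sub_mul_le h0 (hF.mono hmem) (ε := ε) fun τ hτ => by
        rw [abs_sub_comm]
        exact (H₂ _ hr _ (hmem τ hτ) ((hdist τ hτ).trans_lt hn₂)).le
      rw [abs_sub_comm] at hint
      refine le_of_eq_of_le (congrArg abs ?_) hint
      have hadd := intervalIntegral.integral_add_adjacent_intervals
        (hFi le_rfl hr.1 hr.2) (hFi hr.1 (by linarith) hr'.2)
      rw [huF _ hr', ← hadd, sub_eq_sub_iff_add_eq_add]
      nth_rw 1 [huF _ hr]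
      simp only [F, G]
      ring
  rw [Metric.tendsto_nhds]
  intro η hη
  set L := (t - s) * Real.exp ((t - s) * C)
  have hL : 0 ≤ L := mul_nonneg (by linarith) (Real.exp_nonneg _)
  have hRL : Tendsto (fun n : ℕ => (t - s) / n * (R * L)) atTop (nhds 0) := by
    simpa using hstep0.mul_const (R * L)
  filter_upwards [herr (η / (4 * (L + 1))) (by positivity),
    hRL.eventually_lt_const (half_pos hη)] with n hn hn'
  rw [Real.dist_eq]
  refine hn.trans_lt ?_
  have hLη : L * (2 * (η / (4 * (L + 1)))) ≤ η / 2 := by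
    have : 2 * (η / (4 * (L + 1))) * (L + 1) = η / 2 := by
      field_simp
      norm_num
    rw [← this, mul_comm]
    gcongr
    linarith
  linear_combination hLη + hn'
end
end
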